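/- Let X be a non-degenerate self-decomposable random vector in ℝ^d without Gaussian component, with characteristic function φ(ξ) = exp( i⟨b,ξ⟩ + ∫ (e^{i⟨ξ,u⟩} − 1 − i⟨ξ,u⟩1_{‖u‖≤1}) ν(du) ) and Lévy measure ν(du) = 1_{(0,∞)}(r) 1_{S^{d−1}}(x)(k_x(r)/r) dr σ(dx), where σ is a finite positive measure on S^{d−1} and k_x(r) ≥ 0 is nonincreasing and continuous in r ∈ (0,∞), continuous in x ∈ S^{d−1}, with lim_{r→0⁺} r² k_x(r) = 0 and lim_{r→∞} k_x(r) = 0 for every x. For t ≥ 0 let μ_t be the probability measure with characteristic function φ_t(ξ) = φ(ξ)/φ(e^{−t}ξ) (μ_0 = δ_0) and let P_t^ν(h)(x) = ∫ h(x e^{−t} + y) μ_t(dy). Then for every f ∈ S(ℝ^d) and every x ∈ ℝ^d, lim_{t→0⁺} (P_t^ν(f)(x) − f(x))/t = A(f)(x), where A(f)(x) = ⟨ b − ∫_{S^{d−1}} k_y(1) y σ(dy) − x , ∇f(x) ⟩ + ∫_{ℝ^d} ( f(x+u) − f(x) − ⟨∇f(x), u⟩ 1_{‖u‖≤1} ) ν̃(du),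 and ν̃(du) = 1_{(0,∞)}(r) 1_{S^{d−1}}(x)(−dk_x(r)) σ(dx). -/

import Mathlib

open MeasureTheory ProbabilityTheory Filter Set
open scoped RealInnerProductSpace ENNReal NNReal Topology

noncomputable section

/-- The characteristic function of a measure on `ℝ^d`. -/
def charFn {d : ℕ} (μ : Measure (EuclideanSpace ℝ (Fin d)))
    (ξ : EuclideanSpace ℝ (Fin d)) : ℂ :=
  ∫ x, Complex.exp (Complex.I * (⟪ξ, x⟫ : ℂ)) ∂μ

/-- The semigroup of operators `P_t^ν(h)(x) = ∫ h(x e^{−t} + y) μ_t(dy)`. -/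
def Pop {d : ℕ} (μt : ℝ → Measure (EuclideanSpace ℝ (Fin d)))
    (h : EuclideanSpace ℝ (Fin d) → ℝ) (t : ℝ) (x : EuclideanSpace ℝ (Fin d)) : ℝ :=
  ∫ y, h (Real.exp (-t) • x + y) ∂(μt t)

section CompensatedExponential

variable {E : Type*} [NormedAddCommGroup E] [InnerProductSpace ℝ E]

/-- The compensated exponential of the Lévy–Khintchine formula. -/
def compExp (ξ u : E) : ℂ :=
  Complex.exp (Complex.I * ((⟪ξ, u⟫ : ℝ) : ℂ)) - 1
    - (if ‖u‖ ≤ 1 then Complex.I * ((⟪ξ, u⟫ : ℝ) : ℂ) else 0)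

lemma norm_exp_I_mul_ofReal_sub_one_le_two (θ : ℝ) :
    ‖Complex.exp (Complex.I * (θ : ℂ)) - 1‖ ≤ 2 := by
  calc ‖Complex.exp (Complex.I * (θ : ℂ)) - 1‖
      ≤ ‖Complex.exp (Complex.I * (θ : ℂ))‖ + ‖(1 : ℂ)‖ := norm_sub_le _ _
    _ = 2 := by rw [Complex.norm_exp_I_mul_ofReal]; norm_num

lemma norm_exp_I_mul_ofReal_sub_one_sub_le (θ : ℝ) :
    ‖Complex.exp (Complex.I * (θ : ℂ)) - 1 - Complex.I * (θ : ℂ)‖ ≤ 3 * θ ^ 2 := by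
  have hn : ‖Complex.I * (θ : ℂ)‖ = |θ| := by simp
  rcases le_or_gt |θ| 1 with h | h
  · have := Complex.norm_exp_sub_one_sub_id_le (x := Complex.I * (θ : ℂ)) (by rwa [hn])
    rw [hn, sq_abs] at this
    nlinarith [sq_nonneg θ]
  · have h1 := norm_exp_I_mul_ofReal_sub_one_le_two θ
    have h2 := norm_sub_le (Complex.exp (Complex.I * (θ : ℂ)) - 1) (Complex.I * (θ : ℂ))
    rw [hn] at h2
    rw [← sq_abs θ]
    nlinarith

lemma norm_compExp_le (ξ u : E) :
    ‖compExp ξ u‖ ≤ 3 * (1 + ‖ξ‖ ^ 2) * min 1 (‖u‖ ^ 2) := by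
  unfold compExp
  split_ifs with h
  · have h1 : ‖u‖ ^ 2 ≤ 1 := by nlinarith [norm_nonneg u]
    rw [min_eq_right h1]
    refine (norm_exp_I_mul_ofReal_sub_one_sub_le _).trans ?_
    have h2 : ⟪ξ, u⟫ ^ 2 ≤ (‖ξ‖ * ‖u‖) ^ 2 := by
      rw [← sq_abs]
      exact pow_le_pow_left₀ (abs_nonneg _) (abs_real_inner_le_norm ξ u) 2
    nlinarith [sq_nonneg ‖u‖]
  · have h1 : 1 ≤ ‖u‖ ^ 2 := by nlinarith
    rw [min_eq_left h1, sub_zero]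
    refine (norm_exp_I_mul_ofReal_sub_one_le_two _).trans ?_
    nlinarith [sq_nonneg ‖ξ‖]

lemma continuous_compExp_left (u : E) : Continuous (fun ξ : E => compExp ξ u) := by
  unfold compExp
  split_ifs <;> fun_prop

variable [MeasurableSpace E] [BorelSpace E] [SecondCountableTopology E]

lemma measurable_compExp : Measurable (fun p : E × E => compExp p.1 p.2) := by
  unfold compExp
  have h : Measurable (fun p : E × E => Complex.I * ((⟪p.1, p.2⟫ : ℝ) : ℂ)) := by
    apply Continuous.measurable; fun_prop
  refine ((Complex.measurable_exp.comp h).sub_const 1).sub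
    (Measurable.ite ?_ h measurable_const)
  exact measurableSet_le measurable_snd.norm measurable_const

lemma measurable_compExp_right (ξ : E) : Measurable (fun u : E => compExp ξ u) :=
  Measurable.comp (g := fun p : E × E => compExp p.1 p.2) (f := fun u => (ξ, u))
    measurable_compExp measurable_prodMk_left

lemma integrable_compExp {N : Measure E} (hN : Integrable (fun u : E => min 1 (‖u‖ ^ 2)) N)
    (ξ : E) : Integrable (fun u => compExp ξ u) N :=
  (hN.const_mul (3 * (1 + ‖ξ‖ ^ 2))).mono' (measurable_compExp_right ξ).aestronglyMeasurable
    (ae_of_all _ fun u => norm_compExp_le ξ u)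

end CompensatedExponential

section Oscillation

lemma min_one_sq_le_one_sub_cos {x : ℝ} (hx : |x| ≤ Real.pi) :
    min 1 (x ^ 2) ≤ 5 * (1 - Real.cos x) := by
  have h := Real.cos_le_one_sub_mul_cos_sq hx
  have hp : Real.pi ^ 2 ≤ 10 := by nlinarith [Real.pi_lt_d2, Real.pi_pos]
  have h2 : 1 / 5 ≤ 2 / Real.pi ^ 2 := by
    rw [div_le_div_iff₀ (by norm_num) (by positivity)]; linarith
  have h3 := min_le_right 1 (x ^ 2)
  nlinarith [sq_nonneg x]

lemma setLIntegral_Ioi_add_right (F : ℝ → ℝ≥0∞) (p : ℝ) :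
    ∫⁻ r in Ioi p, F r = ∫⁻ r in Ioi (0 : ℝ), F (r + p) := by
  have h := (measurePreserving_add_right (volume : Measure ℝ) p).setLIntegral_comp_preimage_emb
    (measurableEmbedding_addRight p) F (Ioi p)
  rw [← h]
  congr 2
  ext r; simp

lemma setLIntegral_Ioi_le_of_antitoneOn {H : ℝ → ℝ≥0∞} (hH : AntitoneOn H (Ioi 0)) {a : ℝ}
    (ha : 0 < a) :
    ∫⁻ r in Ioi (Real.pi / a), H r
      ≤ ∫⁻ r in Ioi (0 : ℝ), ENNReal.ofReal (1 - Real.cos (a * r)) * H r := by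
  set R := ∫⁻ r in Ioi (0 : ℝ), ENNReal.ofReal (1 - Real.cos (a * r)) * H r with hR
  set p := Real.pi / a with hp
  have hp0 : 0 < p := div_pos Real.pi_pos ha
  have hap : a * p = Real.pi := by rw [hp]; field_simp
  have h1 : ∫⁻ r in Ioi p, ENNReal.ofReal (1 - Real.cos (a * r)) * H r ≤ R :=
    lintegral_mono_set (Ioi_subset_Ioi hp0.le)
  have h2 : ∫⁻ r in Ioi p, ENNReal.ofReal (1 + Real.cos (a * r)) * H r ≤ R := by
    rw [setLIntegral_Ioi_add_right]
    refine setLIntegral_mono' measurableSet_Ioi fun r hr => ?_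
    have hr' : (0 : ℝ) < r := hr
    rw [mul_add, hap, Real.cos_add_pi]
    refine mul_le_mul' (by rw [← sub_eq_add_neg]) (hH hr ?_ (by linarith))
    exact mem_Ioi.2 (by linarith)
  have hm : AEMeasurable H (volume.restrict (Ioi p)) :=
    (aemeasurable_restrict_of_antitoneOn measurableSet_Ioi hH).mono_measure
      (Measure.restrict_mono_set _ (Ioi_subset_Ioi hp0.le))
  have hc : AEMeasurable (fun r => ENNReal.ofReal (1 - Real.cos (a * r)))
      (volume.restrict (Ioi p)) := by
    apply Measurable.aemeasurable; fun_prop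
  have hcm : AEMeasurable (fun r => ENNReal.ofReal (1 - Real.cos (a * r)) * H r)
      (volume.restrict (Ioi p)) := hc.mul hm
  have h3 : 2 * ∫⁻ r in Ioi p, H r ≤ 2 * R := by
    rw [← lintegral_const_mul'' _ hm, two_mul R]
    refine le_trans (le_of_eq ?_) (add_le_add h1 h2)
    rw [← lintegral_add_left' hcm]
    refine lintegral_congr fun r => ?_
    rw [← add_mul, ← ENNReal.ofReal_add (by linarith [Real.cos_le_one (a * r)])
      (by linarith [Real.neg_one_le_cos (a * r)])]
    congr 1
    norm_num
  exact (ENNReal.mul_le_mul_iff_right two_ne_zero ENNReal.ofNat_ne_top).1 h3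

lemma setLIntegral_min_sq_le_of_pos {H : ℝ → ℝ≥0∞} (hH : AntitoneOn H (Ioi 0)) {a : ℝ}
    (ha : 0 < a) :
    ∫⁻ r in Ioi (0 : ℝ), ENNReal.ofReal (min 1 ((a * r) ^ 2)) * H r
      ≤ 6 * ∫⁻ r in Ioi (0 : ℝ), ENNReal.ofReal (1 - Real.cos (a * r)) * H r := by
  have hp0 : 0 < Real.pi / a := div_pos Real.pi_pos ha
  have hm : AEMeasurable H (volume.restrict (Ioi 0)) :=
    aemeasurable_restrict_of_antitoneOn measurableSet_Ioi hH
  have hc : AEMeasurable (fun r => ENNReal.ofReal (1 - Real.cos (a * r)))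
      (volume.restrict (Ioi 0)) := by
    apply Measurable.aemeasurable; fun_prop
  have hcm : AEMeasurable (fun r => ENNReal.ofReal (1 - Real.cos (a * r)) * H r)
      (volume.restrict (Ioi 0)) := hc.mul hm
  rw [← Ioc_union_Ioi_eq_Ioi hp0.le]
  refine (lintegral_union_le _ _ _).trans ?_
  rw [Ioc_union_Ioi_eq_Ioi hp0.le, show (6 : ℝ≥0∞) = 5 + 1 by norm_num, add_mul, one_mul]
  refine add_le_add ?_ (le_trans ?_ (setLIntegral_Ioi_le_of_antitoneOn hH ha))
  · rw [← lintegral_const_mul'' _ hcm]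
    refine le_trans ?_ (lintegral_mono_set (Ioc_subset_Ioi_self : Ioc 0 (Real.pi / a) ⊆ Ioi 0))
    refine setLIntegral_mono' measurableSet_Ioc fun r hr => ?_
    rw [← mul_assoc, show (5 : ℝ≥0∞) = ENNReal.ofReal 5 by norm_num,
      ← ENNReal.ofReal_mul (by norm_num)]
    refine mul_le_mul_left (ENNReal.ofReal_le_ofReal (min_one_sq_le_one_sub_cos ?_)) _
    rw [abs_of_pos (mul_pos ha hr.1)]
    have := (le_div_iff₀ ha).1 hr.2
    linarith
  · refine lintegral_mono fun r => ?_
    calc _ ≤ ENNReal.ofReal 1 * H r :=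
          mul_le_mul_left (ENNReal.ofReal_le_ofReal (min_le_left _ _)) _
      _ = H r := by simp

lemma setLIntegral_min_sq_le {H : ℝ → ℝ≥0∞} (hH : AntitoneOn H (Ioi 0)) (a : ℝ) :
    ∫⁻ r in Ioi (0 : ℝ), ENNReal.ofReal (min 1 ((a * r) ^ 2)) * H r
      ≤ 6 * ∫⁻ r in Ioi (0 : ℝ), ENNReal.ofReal (1 - Real.cos (a * r)) * H r := by
  rcases lt_trichotomy a 0 with h | h | h
  · have := setLIntegral_min_sq_le_of_pos hH (neg_pos.2 h)
    simpa using this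
  · simp [h]
  · exact setLIntegral_min_sq_le_of_pos hH h

end Oscillation

section StieltjesTail

variable {τ : Measure ℝ} {κ : ℝ → ℝ}

lemma measure_Ioi_of_measure_Ioc
    (hτ : ∀ a c : ℝ, 0 < a → a ≤ c → τ (Ioc a c) = ENNReal.ofReal (κ a - κ c))
    (hκ : Tendsto κ atTop (𝓝 0)) {r : ℝ} (hr : 0 < r) :
    τ (Ioi r) = ENNReal.ofReal (κ r) := by
  have hU : Ioi r = ⋃ n : ℕ, Ioc r (r + n) := by
    ext y
    simp only [mem_Ioi, mem_iUnion, mem_Ioc]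
    constructor
    · intro h
      obtain ⟨n, hn⟩ := exists_nat_ge (y - r)
      exact ⟨n, h, by linarith⟩
    · rintro ⟨n, h, -⟩
      exact h
  have hmono : Monotone (fun n : ℕ => Ioc r (r + n)) := fun m n hmn =>
    Ioc_subset_Ioc_right (by gcongr)
  have h1 : Tendsto (fun n : ℕ => τ (Ioc r (r + n))) atTop (𝓝 (τ (Ioi r))) := by
    rw [hU]
    exact tendsto_measure_iUnion_atTop hmono
  have h2 : Tendsto (fun n : ℕ => κ r - κ (r + n)) atTop (𝓝 (κ r - 0)) :=
    tendsto_const_nhds.sub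
      (hκ.comp (tendsto_atTop_add_const_left _ r tendsto_natCast_atTop_atTop))
  rw [sub_zero] at h2
  refine tendsto_nhds_unique h1 ?_
  refine ((ENNReal.continuous_ofReal.tendsto _).comp h2).congr fun n => ?_
  exact (hτ r (r + n) hr (by simp)).symm

lemma sigmaFinite_of_measure_Ioi (h0 : τ (Iic 0) = 0)
    (hτ : ∀ r : ℝ, 0 < r → τ (Ioi r) = ENNReal.ofReal (κ r)) : SigmaFinite τ := by
  refine ⟨⟨{ set := fun n : ℕ => Iic 0 ∪ Ioi (1 / ((n : ℝ) + 1))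
             set_mem := fun _ => trivial
             finite := fun n => ?_
             spanning := ?_ }⟩⟩
  · refine (measure_union_le _ _).trans_lt ?_
    rw [h0, hτ _ (by positivity), zero_add]
    exact ENNReal.ofReal_lt_top
  · refine eq_univ_of_forall fun y => ?_
    rcases le_or_gt y 0 with h | h
    · exact mem_iUnion.2 ⟨0, Or.inl h⟩
    · obtain ⟨n, hn⟩ := exists_nat_one_div_lt h
      exact mem_iUnion.2 ⟨n, Or.inr hn⟩

lemma setLIntegral_Ioo_mul_inv {G : ℝ → ℝ≥0∞} {ρ : ℝ} (hρ : 0 < ρ) :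
    ∫⁻ r in Ioo 0 ρ, G r * ENNReal.ofReal r⁻¹
      = ∫⁻ v in Ioi (0 : ℝ), G (Real.exp (-v) * ρ) := by
  have himg : Ioo 0 ρ = (fun v : ℝ => Real.exp (-v) * ρ) '' Ioi 0 := by
    ext r
    simp only [mem_Ioo, mem_image, mem_Ioi]
    constructor
    · rintro ⟨h1, h2⟩
      refine ⟨-Real.log (r / ρ), ?_, ?_⟩
      · rw [Left.neg_pos_iff]
        exact Real.log_neg (by positivity) ((div_lt_one hρ).2 h2)
      · rw [neg_neg, Real.exp_log (by positivity)]
        field_simp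
    · rintro ⟨v, hv, rfl⟩
      refine ⟨by positivity, ?_⟩
      have : Real.exp (-v) < 1 := by
        rw [← Real.exp_zero]
        exact Real.exp_lt_exp.2 (by linarith)
      nlinarith
  have hder : ∀ v ∈ Ioi (0 : ℝ), HasDerivWithinAt (fun v : ℝ => Real.exp (-v) * ρ)
      (-(Real.exp (-v)) * ρ) (Ioi 0) v := fun v _ => by
    have := ((Real.hasDerivAt_exp (-v)).comp v (hasDerivAt_neg v)).mul_const ρ
    simpa using this.hasDerivWithinAt
  have hinj : InjOn (fun v : ℝ => Real.exp (-v) * ρ) (Ioi 0) := by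
    intro v _ w _ h
    have := mul_right_cancel₀ hρ.ne' h
    simpa using this
  rw [himg, lintegral_image_eq_lintegral_abs_deriv_mul measurableSet_Ioi hder hinj]
  refine lintegral_congr fun v => ?_
  have hpos : 0 < Real.exp (-v) * ρ := by positivity
  rw [neg_mul, abs_neg, abs_of_pos hpos, mul_comm (G _), ← mul_assoc,
    ← ENNReal.ofReal_mul hpos.le, mul_inv_cancel₀ hpos.ne', ENNReal.ofReal_one, one_mul]

lemma setLIntegral_mul_tail (h0 : τ (Iic 0) = 0)
    (hτ : ∀ r : ℝ, 0 < r → τ (Ioi r) = ENNReal.ofReal (κ r))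
    {G : ℝ → ℝ≥0∞} (hG : Measurable G) :
    ∫⁻ r in Ioi (0 : ℝ), G r * ENNReal.ofReal (κ r / r)
      = ∫⁻ ρ, (∫⁻ v in Ioi (0 : ℝ), G (Real.exp (-v) * ρ)) ∂τ := by
  have := sigmaFinite_of_measure_Ioi h0 hτ
  have hmeas : Measurable (fun p : ℝ × ℝ =>
      {q : ℝ × ℝ | q.1 < q.2}.indicator (fun q => G q.1 * ENNReal.ofReal q.1⁻¹) p) := by
    refine Measurable.indicator ?_ (measurableSet_lt measurable_fst measurable_snd)
    exact (hG.comp measurable_fst).mul (measurable_fst.inv.ennreal_ofReal)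
  calc ∫⁻ r in Ioi (0 : ℝ), G r * ENNReal.ofReal (κ r / r)
      = ∫⁻ r in Ioi (0 : ℝ), ∫⁻ ρ, {q : ℝ × ℝ | q.1 < q.2}.indicator
          (fun q => G q.1 * ENNReal.ofReal q.1⁻¹) (r, ρ) ∂τ := by
        refine setLIntegral_congr_fun measurableSet_Ioi fun r hr => ?_
        have hr' : (0 : ℝ) < r := hr
        have : (fun ρ => {q : ℝ × ℝ | q.1 < q.2}.indicator
            (fun q => G q.1 * ENNReal.ofReal q.1⁻¹) (r, ρ))
            = (Ioi r).indicator (fun _ => G r * ENNReal.ofReal r⁻¹) := by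
          ext ρ; simp [indicator]
        simp only [this]
        rw [lintegral_indicator measurableSet_Ioi, setLIntegral_const, hτ r hr', mul_assoc,
          ← ENNReal.ofReal_mul (by positivity)]
        congr 2
        field_simp
    _ = ∫⁻ ρ, (∫⁻ r in Ioi (0 : ℝ), {q : ℝ × ℝ | q.1 < q.2}.indicator
          (fun q => G q.1 * ENNReal.ofReal q.1⁻¹) (r, ρ)) ∂τ :=
        lintegral_lintegral_swap hmeas.aemeasurable
    _ = _ := by
        refine lintegral_congr_ae ?_
        have hae : ∀ᵐ ρ ∂τ, 0 < ρ := by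
          rw [ae_iff]
          convert h0 using 2
          ext; simp
        filter_upwards [hae] with ρ hρ
        rw [← setLIntegral_Ioo_mul_inv hρ]
        have : (fun r => {q : ℝ × ℝ | q.1 < q.2}.indicator
            (fun q => G q.1 * ENNReal.ofReal q.1⁻¹) (r, ρ))
            = (Iio ρ).indicator (fun r => G r * ENNReal.ofReal r⁻¹) := by
          ext r; simp [indicator]
        rw [this, setLIntegral_indicator measurableSet_Iio, inter_comm, Ioi_inter_Iio]

end StieltjesTail

section Radial

variable {E : Type*} [NormedAddCommGroup E] [InnerProductSpace ℝ E] [SecondCountableTopology E]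
  [MeasurableSpace E] [BorelSpace E]

/-- The image of `N ⊗ Leb(0, ∞)` under `(u, v) ↦ e^{-v} u`. -/
def radialMeasure (N : Measure E) : Measure E :=
  (N.prod (volume.restrict (Ioi (0 : ℝ)))).map (fun p => Real.exp (-p.2) • p.1)

lemma measurable_exp_neg_smul :
    Measurable (fun p : E × ℝ => Real.exp (-p.2) • p.1) := by
  apply Continuous.measurable; fun_prop

lemma lintegral_eq_of_polar {ν N σ : Measure E} {τ : E → Measure ℝ} {k : E → ℝ → ℝ}
    (hσ : ∀ᵐ x ∂σ, ‖x‖ = 1)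
    (h0 : ∀ x, τ x (Iic 0) = 0)
    (hτ : ∀ x, ‖x‖ = 1 → ∀ r : ℝ, 0 < r → τ x (Ioi r) = ENNReal.ofReal (k x r))
    (hpolar : ∀ g : E → ℝ≥0∞, Measurable g → ∫⁻ u, g u ∂ν
        = ∫⁻ x, (∫⁻ r in Ioi (0 : ℝ), g (r • x) * ENNReal.ofReal (k x r / r)) ∂σ)
    (hN : ∀ g : E → ℝ≥0∞, Measurable g →
      ∫⁻ u, g u ∂N = ∫⁻ x, (∫⁻ r, g (r • x) ∂(τ x)) ∂σ)
    {g : E → ℝ≥0∞} (hg : Measurable g) :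
    ∫⁻ u, g u ∂ν = ∫⁻ u, (∫⁻ v in Ioi (0 : ℝ), g (Real.exp (-v) • u)) ∂N := by
  have hm : Measurable (fun u : E => ∫⁻ v in Ioi (0 : ℝ), g (Real.exp (-v) • u)) :=
    Measurable.lintegral_prod_right'
      (f := fun p : E × ℝ => g (Real.exp (-p.2) • p.1)) (hg.comp measurable_exp_neg_smul)
  rw [hpolar g hg, hN _ hm]
  refine lintegral_congr_ae ?_
  filter_upwards [hσ] with x hx
  have hGm : Measurable (fun r : ℝ => g (r • x)) :=
    hg.comp (by apply Continuous.measurable; fun_prop)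
  rw [setLIntegral_mul_tail (h0 x) (hτ x hx) hGm]
  refine lintegral_congr fun ρ => lintegral_congr fun v => ?_
  rw [mul_smul]

lemma sigmaFinite_of_integrable_min {N : Measure E} (h0 : N {0} = 0)
    (hN : Integrable (fun u : E => min 1 (‖u‖ ^ 2)) N) : SigmaFinite N := by
  refine ⟨⟨{ set := fun n : ℕ => {0} ∪ {u : E | 1 / ((n : ℝ) + 1) < min 1 (‖u‖ ^ 2)}
             set_mem := fun _ => trivial
             finite := fun n => ?_
             spanning := ?_ }⟩⟩
  · refine (measure_union_le _ _).trans_lt ?_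
    rw [h0, zero_add]
    exact hN.measure_gt_lt_top (by positivity)
  · refine eq_univ_of_forall fun y => ?_
    by_cases h : y = 0
    · exact mem_iUnion.2 ⟨0, Or.inl h⟩
    · have h1 : 0 < min 1 (‖y‖ ^ 2) := lt_min one_pos (by positivity)
      obtain ⟨n, hn⟩ := exists_nat_one_div_lt h1
      exact mem_iUnion.2 ⟨n, Or.inr hn⟩

lemma eq_radialMeasure {ν N : Measure E} [SigmaFinite N]
    (h : ∀ g : E → ℝ≥0∞, Measurable g →
      ∫⁻ u, g u ∂ν = ∫⁻ u, (∫⁻ v in Ioi (0 : ℝ), g (Real.exp (-v) • u)) ∂N) :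
    ν = radialMeasure N := by
  ext s hs
  have hi : Measurable (s.indicator (1 : E → ℝ≥0∞)) := measurable_one.indicator hs
  rw [← lintegral_indicator_one hs, ← lintegral_indicator_one hs, h _ hi, radialMeasure,
    lintegral_map hi measurable_exp_neg_smul, lintegral_prod]
  exact (hi.comp measurable_exp_neg_smul).aemeasurable

lemma integrable_min_of_lintegral {N : Measure E}
    (h : ∫⁻ u : E, ENNReal.ofReal (min 1 (‖u‖ ^ 2)) ∂N < ∞) :
    Integrable (fun u : E => min 1 (‖u‖ ^ 2)) N := by
  refine ⟨by apply Continuous.aestronglyMeasurable; fun_prop, ?_⟩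
  rw [hasFiniteIntegral_iff_ofReal (ae_of_all _ fun u => by positivity)]
  exact h

lemma lintegral_min_lt_top_of_radial {ν N : Measure E}
    (h : ∀ g : E → ℝ≥0∞, Measurable g →
      ∫⁻ u, g u ∂ν = ∫⁻ u, (∫⁻ v in Ioi (0 : ℝ), g (Real.exp (-v) • u)) ∂N)
    (hν : ∫⁻ u : E, ENNReal.ofReal (min 1 (‖u‖ ^ 2)) ∂ν < ∞) :
    ∫⁻ u : E, ENNReal.ofReal (min 1 (‖u‖ ^ 2)) ∂N < ∞ := by
  rw [h _ (by fun_prop)] at hν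
  have hle : ENNReal.ofReal (Real.exp (-1) ^ 2) * ∫⁻ u : E, ENNReal.ofReal (min 1 (‖u‖ ^ 2)) ∂N
      ≤ ∫⁻ u, (∫⁻ v in Ioi (0 : ℝ), ENNReal.ofReal (min 1 (‖Real.exp (-v) • u‖ ^ 2))) ∂N := by
    rw [← lintegral_const_mul _ (by fun_prop)]
    refine lintegral_mono fun u => ?_
    calc ENNReal.ofReal (Real.exp (-1) ^ 2) * ENNReal.ofReal (min 1 (‖u‖ ^ 2))
        = ∫⁻ v in Ioc (0 : ℝ) 1,
            ENNReal.ofReal (Real.exp (-1) ^ 2) * ENNReal.ofReal (min 1 (‖u‖ ^ 2)) := by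
          rw [setLIntegral_const]; simp
      _ ≤ ∫⁻ v in Ioc (0 : ℝ) 1, ENNReal.ofReal (min 1 (‖Real.exp (-v) • u‖ ^ 2)) := by
          refine setLIntegral_mono' measurableSet_Ioc fun v hv => ?_
          rw [← ENNReal.ofReal_mul (by positivity)]
          refine ENNReal.ofReal_le_ofReal ?_
          have h1 : Real.exp (-1) ≤ Real.exp (-v) := Real.exp_le_exp.2 (by linarith [hv.2])
          have h2 : Real.exp (-1) ≤ 1 := Real.exp_le_one_iff.2 (by norm_num)
          have h3 := Real.exp_pos (-1)
          rw [norm_smul, Real.norm_of_nonneg (Real.exp_pos _).le, mul_pow]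
          refine le_min ?_ ?_
          · have := min_le_left 1 (‖u‖ ^ 2)
            have h4 : 0 ≤ min 1 (‖u‖ ^ 2) := by positivity
            nlinarith
          · refine mul_le_mul (pow_le_pow_left₀ h3.le h1 2) (min_le_right _ _) (by positivity)
              (by positivity)
      _ ≤ _ := lintegral_mono_set Ioc_subset_Ioi_self
  by_contra hcon
  rw [not_lt, top_le_iff] at hcon
  rw [hcon, ENNReal.mul_top (by positivity)] at hle
  exact absurd hν (not_lt.2 hle)

end Radial

section Drift

variable {E : Type*} [NormedAddCommGroup E] [InnerProductSpace ℝ E] [FiniteDimensional ℝ E]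
  [MeasurableSpace E] [BorelSpace E]

/-- The radially projected jump of size larger than one, tested against `ξ`. -/
def bigJump (ξ u : E) : ℝ := if ‖u‖ ≤ 1 then 0 else ⟪ξ, u⟫ / ‖u‖

lemma measurable_bigJump (ξ : E) : Measurable (bigJump ξ) := by
  unfold bigJump
  refine Measurable.ite (measurableSet_le measurable_norm measurable_const) measurable_const ?_
  exact (Continuous.measurable (by fun_prop)).div measurable_norm

lemma abs_bigJump_le (ξ u : E) : |bigJump ξ u| ≤ ‖ξ‖ * min 1 (‖u‖ ^ 2) := by
  unfold bigJump
  split_ifs with h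
  · simp; positivity
  · have h1 : 1 ≤ ‖u‖ ^ 2 := by nlinarith
    have h2 : 0 < ‖u‖ := by linarith
    rw [min_eq_left h1, mul_one, abs_div, abs_of_pos h2, div_le_iff₀ h2]
    exact abs_real_inner_le_norm ξ u

lemma integrable_bigJump {N : Measure E} (hN : Integrable (fun u : E => min 1 (‖u‖ ^ 2)) N)
    (ξ : E) : Integrable (bigJump ξ) N :=
  (hN.const_mul ‖ξ‖).mono' (measurable_bigJump ξ).aestronglyMeasurable
    (ae_of_all _ fun u => abs_bigJump_le ξ u)

lemma lintegral_bigJump {N σ : Measure E} {τ : E → Measure ℝ} {k : E → ℝ → ℝ}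
    (hσ : ∀ᵐ x ∂σ, ‖x‖ = 1) (hk0 : ∀ x, ∀ r : ℝ, 0 < r → 0 ≤ k x r)
    (h0 : ∀ x, τ x (Iic 0) = 0)
    (hτ : ∀ x, ‖x‖ = 1 → ∀ r : ℝ, 0 < r → τ x (Ioi r) = ENNReal.ofReal (k x r))
    (hN : ∀ g : E → ℝ≥0∞, Measurable g →
      ∫⁻ u, g u ∂N = ∫⁻ x, (∫⁻ r, g (r • x) ∂(τ x)) ∂σ) (ξ : E) :
    ∫⁻ u, ENNReal.ofReal (bigJump ξ u) ∂N = ∫⁻ x, ENNReal.ofReal ⟪ξ, k x 1 • x⟫ ∂σ := by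
  rw [hN _ (measurable_bigJump ξ).ennreal_ofReal]
  refine lintegral_congr_ae ?_
  filter_upwards [hσ] with x hx
  have hae : ∀ᵐ ρ ∂(τ x), 0 < ρ := by
    rw [ae_iff]
    convert h0 x using 2
    ext; simp
  have : ∫⁻ r, ENNReal.ofReal (bigJump ξ (r • x)) ∂(τ x)
      = ∫⁻ r, (Ioi (1 : ℝ)).indicator (fun _ => ENNReal.ofReal ⟪ξ, x⟫) r ∂(τ x) := by
    refine lintegral_congr_ae ?_
    filter_upwards [hae] with r hr
    simp only [bigJump, norm_smul, hx, Real.norm_of_nonneg hr.le, mul_one, indicator, mem_Ioi]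
    by_cases h : r ≤ 1
    · simp [h]
    · rw [if_neg h, if_pos (not_le.1 h), real_inner_smul_right]
      congr 1
      field_simp
  rw [this, lintegral_indicator measurableSet_Ioi, setLIntegral_const, hτ x hx 1 one_pos,
    ← ENNReal.ofReal_mul' (hk0 x 1 one_pos), real_inner_smul_right, mul_comm]

lemma integrable_smul_self_of_continuousOn_sphere {σ : Measure E} [IsFiniteMeasure σ]
    (hσ : ∀ᵐ x ∂σ, ‖x‖ = 1) {κ : E → ℝ} (hκ : ContinuousOn κ {x : E | ‖x‖ = 1}) :
    Integrable (fun x => κ x • x) σ := by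
  have hs : {x : E | ‖x‖ = 1} = Metric.sphere 0 1 := by ext; simp
  have hc : IsCompact {x : E | ‖x‖ = 1} := hs ▸ isCompact_sphere 0 1
  have h1 : IntegrableOn (fun x => κ x • x) {x : E | ‖x‖ = 1} σ :=
    (hκ.smul continuousOn_id).integrableOn_compact hc
  have h2 : σ.restrict {x : E | ‖x‖ = 1} = σ := Measure.restrict_eq_self_of_ae_mem hσ
  rwa [IntegrableOn, h2] at h1

lemma integral_bigJump {N σ : Measure E} [IsFiniteMeasure σ] {τ : E → Measure ℝ}
    {k : E → ℝ → ℝ}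
    (hσ : ∀ᵐ x ∂σ, ‖x‖ = 1) (hk0 : ∀ x, ∀ r : ℝ, 0 < r → 0 ≤ k x r)
    (hkc : ContinuousOn (fun x => k x 1) {x : E | ‖x‖ = 1})
    (h0 : ∀ x, τ x (Iic 0) = 0)
    (hτ : ∀ x, ‖x‖ = 1 → ∀ r : ℝ, 0 < r → τ x (Ioi r) = ENNReal.ofReal (k x r))
    (hN : ∀ g : E → ℝ≥0∞, Measurable g →
      ∫⁻ u, g u ∂N = ∫⁻ x, (∫⁻ r, g (r • x) ∂(τ x)) ∂σ)
    (hmin : Integrable (fun u : E => min 1 (‖u‖ ^ 2)) N) (ξ : E) :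
    ∫ u, bigJump ξ u ∂N = ⟪ξ, ∫ y, k y 1 • y ∂σ⟫ := by
  have hint := integrable_smul_self_of_continuousOn_sphere hσ hkc
  rw [← integral_inner hint,
    integral_eq_lintegral_pos_part_sub_lintegral_neg_part (integrable_bigJump hmin ξ),
    integral_eq_lintegral_pos_part_sub_lintegral_neg_part (hint.const_inner ξ),
    lintegral_bigJump hσ hk0 h0 hτ hN]
  have hneg := lintegral_bigJump hσ hk0 h0 hτ hN (-ξ)
  have hb : ∀ u, bigJump (-ξ) u = -bigJump ξ u := fun u => by
    unfold bigJump
    split_ifs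
    · simp
    · rw [inner_neg_left, neg_div]
  simp only [hb, inner_neg_left] at hneg
  rw [hneg]

end Drift

section Nondegenerate

variable {E : Type*} [NormedAddCommGroup E] [InnerProductSpace ℝ E] [FiniteDimensional ℝ E]
  [MeasurableSpace E] [BorelSpace E]

lemma lintegral_min_inner_sq_le {ν σ : Measure E} {k : E → ℝ → ℝ}
    (hk0 : ∀ x, ∀ r : ℝ, 0 < r → 0 ≤ k x r) (hkmono : ∀ x, AntitoneOn (k x) (Ioi 0))
    (hpolar : ∀ g : E → ℝ≥0∞, Measurable g → ∫⁻ u, g u ∂ν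
        = ∫⁻ x, (∫⁻ r in Ioi (0 : ℝ), g (r • x) * ENNReal.ofReal (k x r / r)) ∂σ) (ξ : E) :
    ∫⁻ u, ENNReal.ofReal (min 1 (⟪ξ, u⟫ ^ 2)) ∂ν
      ≤ 6 * ∫⁻ u, ENNReal.ofReal (1 - Real.cos ⟪ξ, u⟫) ∂ν := by
  rw [hpolar _ (Measurable.ennreal_ofReal (Continuous.measurable (by fun_prop))),
    hpolar _ (Measurable.ennreal_ofReal (Continuous.measurable (by fun_prop))),
    ← lintegral_const_mul' _ _ (by simp)]
  refine lintegral_mono fun x => ?_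
  have hH : AntitoneOn (fun r => ENNReal.ofReal (k x r / r)) (Ioi 0) := by
    intro r hr s hs hrs
    refine ENNReal.ofReal_le_ofReal ?_
    exact div_le_div₀ (hk0 x r hr) (hkmono x hr hs hrs) hr hrs
  have := setLIntegral_min_sq_le hH ⟪ξ, x⟫
  simpa only [real_inner_smul_right, mul_comm ⟪ξ, x⟫] using this

lemma lintegral_one_sub_cos_lt_top {ν : Measure E} {ξ : E}
    (h : Integrable (fun u => compExp ξ u) ν) :
    ∫⁻ u, ENNReal.ofReal (1 - Real.cos ⟪ξ, u⟫) ∂ν < ∞ := by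
  have h1 := h.re.neg
  have h2 : ∀ u : E, -(RCLike.re (compExp ξ u)) = 1 - Real.cos ⟪ξ, u⟫ := fun u => by
    have h3 : (Complex.exp (Complex.I * ((⟪ξ, u⟫ : ℝ) : ℂ))).re = Real.cos ⟪ξ, u⟫ := by
      rw [mul_comm, Complex.exp_ofReal_mul_I_re]
    unfold compExp
    rw [RCLike.re_eq_complex_re, Complex.sub_re, Complex.sub_re, h3]
    split_ifs <;> simp
  have h4 := h1.2
  rw [hasFiniteIntegral_iff_ofReal] at h4
  · simpa only [Pi.neg_apply, h2] using h4
  · refine ae_of_all _ fun u => ?_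
    simp only [Pi.neg_apply, h2, Pi.zero_apply]
    linarith [Real.cos_le_one ⟪ξ, u⟫]

lemma lintegral_min_lt_top_of_inner {ν : Measure E}
    (h : ∀ v : E, v ≠ 0 → ∃ c : ℝ, c ≠ 0 ∧
      ∫⁻ u, ENNReal.ofReal (min 1 (⟪c • v, u⟫ ^ 2)) ∂ν < ∞) :
    ∫⁻ u : E, ENNReal.ofReal (min 1 (‖u‖ ^ 2)) ∂ν < ∞ := by
  let e := stdOrthonormalBasis ℝ E
  have key : ∀ i, ∫⁻ u, ENNReal.ofReal (min 1 (⟪e i, u⟫ ^ 2)) ∂ν < ∞ := by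
    intro i
    obtain ⟨c, hc, hfin⟩ := h (e i) (e.orthonormal.ne_zero i)
    refine lt_of_le_of_lt ?_
      (ENNReal.mul_lt_top (ENNReal.ofReal_lt_top (r := 1 + (c ^ 2)⁻¹)) hfin)
    rw [← lintegral_const_mul _ (Measurable.ennreal_ofReal (Continuous.measurable (by fun_prop)))]
    refine lintegral_mono fun u => ?_
    simp only
    rw [← ENNReal.ofReal_mul (by positivity)]
    refine ENNReal.ofReal_le_ofReal ?_
    rw [real_inner_smul_left, mul_pow]
    have hc2 : 0 < c ^ 2 := by positivity
    rcases le_total 1 (c ^ 2 * ⟪e i, u⟫ ^ 2) with h1 | h1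
    · rw [min_eq_left h1]
      have := min_le_left 1 (⟪e i, u⟫ ^ 2)
      have : 0 < (c ^ 2)⁻¹ := by positivity
      linarith
    · rw [min_eq_right h1, add_mul, inv_mul_cancel_left₀ hc2.ne']
      have := min_le_right 1 (⟪e i, u⟫ ^ 2)
      have : 0 ≤ c ^ 2 * ⟪e i, u⟫ ^ 2 := by positivity
      linarith
  calc ∫⁻ u : E, ENNReal.ofReal (min 1 (‖u‖ ^ 2)) ∂ν
      ≤ ∫⁻ u : E, ∑ i, ENNReal.ofReal (min 1 (⟪e i, u⟫ ^ 2)) ∂ν := by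
        refine lintegral_mono fun u => ?_
        simp only
        rw [← ENNReal.ofReal_sum_of_nonneg (fun i _ => by positivity)]
        refine ENNReal.ofReal_le_ofReal ?_
        by_cases hex : ∃ i, 1 ≤ ⟪e i, u⟫ ^ 2
        · obtain ⟨i, hi⟩ := hex
          refine (min_le_left _ _).trans ?_
          have := Finset.single_le_sum (f := fun i => min 1 (⟪e i, u⟫ ^ 2))
            (fun i _ => by positivity) (Finset.mem_univ i)
          simpa [min_eq_left hi] using this
        · push Not at hex
          refine (min_le_right _ _).trans (le_of_eq ?_)
          rw [← e.sum_sq_inner_right u]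
          exact Finset.sum_congr rfl fun i _ => (min_eq_right (hex i).le).symm
    _ = ∑ i, ∫⁻ u, ENNReal.ofReal (min 1 (⟪e i, u⟫ ^ 2)) ∂ν :=
        lintegral_finsetSum _ fun i _ =>
          Measurable.ennreal_ofReal (Continuous.measurable (by fun_prop))
    _ < ∞ := ENNReal.sum_lt_top.2 fun i _ => key i

lemma measure_inner_eq_of_charFn {d : ℕ} {μ : Measure (EuclideanSpace ℝ (Fin d))}
    [IsProbabilityMeasure μ] {v : EuclideanSpace ℝ (Fin d)} {a : ℝ}
    (h : ∀ c : ℝ, charFn μ (c • v) = Complex.exp (Complex.I * ((c * a : ℝ) : ℂ))) :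
    μ {x | ⟪v, x⟫ = a} = 1 := by
  have hm : Measurable (fun x : EuclideanSpace ℝ (Fin d) => ⟪v, x⟫) := by
    apply Continuous.measurable; fun_prop
  have : IsProbabilityMeasure (μ.map (fun x => ⟪v, x⟫)) :=
    Measure.isProbabilityMeasure_map hm.aemeasurable
  have heq : μ.map (fun x => ⟪v, x⟫) = Measure.dirac a := by
    refine Measure.ext_of_charFun ?_
    ext c
    rw [charFun_dirac, charFun_apply_real, integral_map hm.aemeasurable (by fun_prop)]
    have h1 := h c
    rw [charFn] at h1
    convert h1 using 2
    · ext x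
      rw [real_inner_smul_left]
      push_cast
      ring_nf
    · simp only [RCLike.inner_apply, conj_trivial]
      push_cast
      ring
  have h2 : μ.map (fun x => ⟪v, x⟫) {a} = 1 := by rw [heq]; simp
  rwa [Measure.map_apply hm (measurableSet_singleton a)] at h2

lemma lintegral_min_lt_top_of_nondegenerate {d : ℕ}
    {μ ν σ : Measure (EuclideanSpace ℝ (Fin d))} [IsProbabilityMeasure μ]
    {b : EuclideanSpace ℝ (Fin d)} {k : EuclideanSpace ℝ (Fin d) → ℝ → ℝ}
    (hnondeg : ∀ (v : EuclideanSpace ℝ (Fin d)) (c : ℝ), v ≠ 0 →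
      μ {x : EuclideanSpace ℝ (Fin d) | ⟪v, x⟫ = c} ≠ 1)
    (hk0 : ∀ x, ∀ r : ℝ, 0 < r → 0 ≤ k x r) (hkmono : ∀ x, AntitoneOn (k x) (Ioi 0))
    (hpolar : ∀ g : EuclideanSpace ℝ (Fin d) → ℝ≥0∞, Measurable g → ∫⁻ u, g u ∂ν
        = ∫⁻ x, (∫⁻ r in Ioi (0 : ℝ), g (r • x) * ENNReal.ofReal (k x r / r)) ∂σ)
    (hchar : ∀ ξ, charFn μ ξ
      = Complex.exp (Complex.I * ((⟪b, ξ⟫ : ℝ) : ℂ) + ∫ u, compExp ξ u ∂ν)) :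
    ∫⁻ u : EuclideanSpace ℝ (Fin d), ENNReal.ofReal (min 1 (‖u‖ ^ 2)) ∂ν < ∞ := by
  refine lintegral_min_lt_top_of_inner fun v hv => ?_
  by_contra! hcon
  refine hnondeg v ⟪b, v⟫ hv (measure_inner_eq_of_charFn fun c => ?_)
  have hzero : ∫ u, compExp (c • v) u ∂ν = 0 := by
    rcases eq_or_ne c 0 with rfl | hc
    · simp [compExp]
    · refine integral_undef fun hint => ?_
      have h1 := (lintegral_min_inner_sq_le hk0 hkmono hpolar (c • v)).trans_lt
        (ENNReal.mul_lt_top (by simp) (lintegral_one_sub_cos_lt_top hint))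
      exact absurd h1 (not_lt.2 (hcon c hc))
  rw [hchar, hzero, add_zero, real_inner_smul_right]

end Nondegenerate

section RadialCumulant

variable {E : Type*} [NormedAddCommGroup E] [InnerProductSpace ℝ E] [FiniteDimensional ℝ E]
  [MeasurableSpace E] [BorelSpace E]

lemma integrableOn_exp_I_mul_exp_neg_sub_one (a : ℝ) :
    IntegrableOn (fun v : ℝ => Complex.exp (Complex.I * ((Real.exp (-v) * a : ℝ) : ℂ)) - 1)
      (Ioi 0) := by
  have hexp : IntegrableOn (fun v : ℝ => Real.exp (-v)) (Ioi 0) := integrableOn_exp_neg_Ioi 0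
  refine Integrable.mono' (hexp.mul_const |a|) (by fun_prop) (ae_of_all _ fun v => ?_)
  refine Real.norm_exp_I_mul_ofReal_sub_one_le.trans (le_of_eq ?_)
  rw [norm_mul, Real.norm_eq_abs, Real.norm_eq_abs, abs_of_pos (Real.exp_pos _)]

lemma integral_Ioi_sub_comp_add_right {g : ℝ → ℂ} (hg : IntegrableOn g (Ioi 0)) {t : ℝ}
    (ht : 0 ≤ t) :
    IntegrableOn (fun v => g (v + t)) (Ioi 0) ∧
      (∫ v in Ioi (0 : ℝ), g v) - ∫ v in Ioi (0 : ℝ), g (v + t) = ∫ v in (0 : ℝ)..t, g v := by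
  have hpre : (fun v : ℝ => v + t) ⁻¹' Ioi t = Ioi 0 := by ext; simp
  have hmp := measurePreserving_add_right (volume : Measure ℝ) t
  have hg' : IntegrableOn g (Ioi t) := hg.mono_set (Ioi_subset_Ioi ht)
  constructor
  · have := (hmp.integrableOn_comp_preimage (measurableEmbedding_addRight t)).2 hg'
    rwa [hpre] at this
  · have := hmp.setIntegral_preimage_emb (measurableEmbedding_addRight t) g (Ioi t)
    rw [hpre] at this
    rw [this, intervalIntegral.integral_Ioi_sub_Ioi hg ht]

lemma integral_Ioi_exp_neg_indicator (u : E) :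
    IntegrableOn (fun v : ℝ => if ‖Real.exp (-v) • u‖ ≤ 1 then Real.exp (-v) else 0) (Ioi 0) ∧
    ∫ v in Ioi (0 : ℝ), (if ‖Real.exp (-v) • u‖ ≤ 1 then Real.exp (-v) else 0)
      = if ‖u‖ ≤ 1 then 1 else ‖u‖⁻¹ := by
  have hexp : IntegrableOn (fun v : ℝ => Real.exp (-v)) (Ioi 0) := integrableOn_exp_neg_Ioi 0
  have hmeas : MeasurableSet {v : ℝ | ‖Real.exp (-v) • u‖ ≤ 1} :=
    measurableSet_le (Continuous.measurable (by fun_prop)) measurable_const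
  have hind : (fun v : ℝ => if ‖Real.exp (-v) • u‖ ≤ 1 then Real.exp (-v) else 0)
      = {v : ℝ | ‖Real.exp (-v) • u‖ ≤ 1}.indicator (fun v => Real.exp (-v)) := by
    ext v; simp [indicator]
  refine ⟨by rw [hind]; exact hexp.indicator hmeas, ?_⟩
  split_ifs with h
  · refine (setIntegral_congr_fun measurableSet_Ioi fun v hv => ?_).trans
      integral_exp_neg_Ioi_zero
    have hv' : (0 : ℝ) < v := hv
    refine if_pos ?_
    rw [norm_smul, Real.norm_of_nonneg (Real.exp_pos _).le]
    have h1 : Real.exp (-v) ≤ 1 := Real.exp_le_one_iff.2 (by linarith)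
    exact mul_le_one₀ h1 (norm_nonneg _) h
  · have h1 : 1 < ‖u‖ := not_le.1 h
    have h0 : 0 < ‖u‖ := by linarith
    have hset : Ioi 0 ∩ {v : ℝ | ‖Real.exp (-v) • u‖ ≤ 1} = Ici (Real.log ‖u‖) := by
      ext v
      simp only [mem_inter_iff, mem_Ioi, mem_ofPred_eq, mem_Ici]
      rw [norm_smul, Real.norm_of_nonneg (Real.exp_pos _).le, Real.exp_neg,
        inv_mul_le_iff₀ (Real.exp_pos _), mul_one, Real.log_le_iff_le_exp h0]
      refine ⟨fun h => h.2, fun h => ⟨?_, h⟩⟩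
      exact Real.exp_lt_exp.1 (by rw [Real.exp_zero]; linarith)
    rw [hind, setIntegral_indicator hmeas, hset, integral_Ici_eq_integral_Ioi,
      integral_exp_neg_Ioi, Real.exp_neg, Real.exp_log h0]

lemma integral_compExp_radial_sub (ξ u : E) {t : ℝ} (ht : 0 ≤ t) :
    ∫ v in Ioi (0 : ℝ), (compExp ξ (Real.exp (-v) • u)
        - compExp (Real.exp (-t) • ξ) (Real.exp (-v) • u))
      = (∫ v in (0 : ℝ)..t, compExp (Real.exp (-v) • ξ) u)
        - Complex.I * (((1 - Real.exp (-t)) * bigJump ξ u : ℝ) : ℂ) := by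
  set a : ℝ := ⟪ξ, u⟫ with ha
  set e : ℝ → ℂ := fun v => Complex.exp (Complex.I * ((Real.exp (-v) * a : ℝ) : ℂ)) - 1 with he
  set m : ℝ → ℝ := fun v => if ‖Real.exp (-v) • u‖ ≤ 1 then Real.exp (-v) else 0 with hm
  have hei : IntegrableOn e (Ioi 0) := integrableOn_exp_I_mul_exp_neg_sub_one a
  obtain ⟨hei', hesub⟩ := integral_Ioi_sub_comp_add_right hei ht
  obtain ⟨hmi, hmint⟩ := integral_Ioi_exp_neg_indicator u
  have hpt : ∀ v : ℝ, compExp ξ (Real.exp (-v) • u)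
        - compExp (Real.exp (-t) • ξ) (Real.exp (-v) • u)
      = (e v - e (v + t)) - Complex.I * ((1 - Real.exp (-t)) * a : ℝ) * (m v : ℂ) := fun v => by
    simp only [compExp, he, hm, real_inner_smul_left, real_inner_smul_right, ← ha, neg_add,
      Real.exp_add]
    split_ifs
    · push_cast; ring_nf
    · push_cast; ring_nf
  have hpt2 : ∀ v : ℝ, compExp (Real.exp (-v) • ξ) u
      = e v - Complex.I * ((if ‖u‖ ≤ 1 then a else 0 : ℝ) : ℂ) * (Real.exp (-v) : ℂ) := fun v => by
    simp only [compExp, he, real_inner_smul_left, ← ha]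
    split_ifs
    · push_cast; ring_nf
    · push_cast; ring_nf
  have hexpint : ∫ v in (0 : ℝ)..t, (Real.exp (-v) : ℂ) = ((1 - Real.exp (-t) : ℝ) : ℂ) := by
    rw [intervalIntegral.integral_ofReal]
    congr 1
    rw [intervalIntegral.integral_comp_neg (fun v => Real.exp v), integral_exp]
    simp
  have hmC : ∫ v in Ioi (0 : ℝ), (m v : ℂ) = ((if ‖u‖ ≤ 1 then 1 else ‖u‖⁻¹ : ℝ) : ℂ) := by
    rw [integral_complex_ofReal, hmint]
  simp only [hpt, hpt2]
  have hei2 : IntegrableOn (fun v => e v - e (v + t)) (Ioi 0) := hei.sub hei'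
  have hmi2 : IntegrableOn
      (fun v => Complex.I * ((1 - Real.exp (-t)) * a : ℝ) * (m v : ℂ)) (Ioi 0) :=
    hmi.ofReal.const_mul _
  have hsplit : ∫ v in (0 : ℝ)..t,
      (e v - Complex.I * ((if ‖u‖ ≤ 1 then a else 0 : ℝ) : ℂ) * (Real.exp (-v) : ℂ))
      = (∫ v in (0 : ℝ)..t, e v) - ∫ v in (0 : ℝ)..t,
        Complex.I * ((if ‖u‖ ≤ 1 then a else 0 : ℝ) : ℂ) * (Real.exp (-v) : ℂ) :=
    intervalIntegral.integral_sub (Continuous.intervalIntegrable (by fun_prop) _ _)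
      (Continuous.intervalIntegrable (by fun_prop) _ _)
  rw [integral_sub hei2 hmi2, integral_sub hei hei', hesub,
    integral_const_mul, hmC, hsplit, intervalIntegral.integral_const_mul, hexpint]
  unfold bigJump
  rw [← ha]
  split_ifs with h
  · push_cast; ring
  · push_cast; ring

lemma norm_compExp_exp_neg_smul_le (ξ u : E) {v : ℝ} (hv : 0 ≤ v) :
    ‖compExp (Real.exp (-v) • ξ) u‖ ≤ 3 * (1 + ‖ξ‖ ^ 2) * min 1 (‖u‖ ^ 2) := by
  refine (norm_compExp_le _ _).trans ?_
  have h : ‖Real.exp (-v) • ξ‖ ≤ ‖ξ‖ := by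
    rw [norm_smul, Real.norm_of_nonneg (Real.exp_pos _).le]
    exact mul_le_of_le_one_left (norm_nonneg _) (Real.exp_le_one_iff.2 (by linarith))
  gcongr

lemma norm_intervalIntegral_compExp_le (ξ u : E) {t : ℝ} (ht : 0 ≤ t) :
    ‖∫ v in (0 : ℝ)..t, compExp (Real.exp (-v) • ξ) u‖
      ≤ t * (3 * (1 + ‖ξ‖ ^ 2)) * min 1 (‖u‖ ^ 2) := by
  have := intervalIntegral.norm_integral_le_of_norm_le_const (a := (0 : ℝ)) (b := t)
    (f := fun v => compExp (Real.exp (-v) • ξ) u) (C := 3 * (1 + ‖ξ‖ ^ 2) * min 1 (‖u‖ ^ 2))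
    fun v hv => by
      rw [uIoc_of_le ht] at hv
      exact norm_compExp_exp_neg_smul_le ξ u hv.1.le
  rw [sub_zero, abs_of_nonneg ht] at this
  linarith

lemma aestronglyMeasurable_intervalIntegral_compExp (N : Measure E) (ξ : E) {t : ℝ}
    (ht : 0 ≤ t) :
    AEStronglyMeasurable (fun u => ∫ v in (0 : ℝ)..t, compExp (Real.exp (-v) • ξ) u) N := by
  have hf : Measurable (fun p : E × ℝ => ((Real.exp (-p.2) • ξ, p.1) : E × E)) :=
    Continuous.measurable (by fun_prop)
  have hm : Measurable (fun p : E × ℝ => compExp (Real.exp (-p.2) • ξ) p.1) :=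
    Measurable.comp (g := fun q : E × E => compExp q.1 q.2)
      (f := fun p : E × ℝ => (Real.exp (-p.2) • ξ, p.1)) measurable_compExp hf
  simp only [intervalIntegral.integral_of_le ht]
  exact (StronglyMeasurable.integral_prod_right' (ν := volume.restrict (Ioc 0 t))
    (f := fun p : E × ℝ => compExp (Real.exp (-p.2) • ξ) p.1)
    hm.stronglyMeasurable).aestronglyMeasurable

lemma integrable_intervalIntegral_compExp {N : Measure E}
    (hN : Integrable (fun u : E => min 1 (‖u‖ ^ 2)) N) (ξ : E) {t : ℝ} (ht : 0 ≤ t) :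
    Integrable (fun u => ∫ v in (0 : ℝ)..t, compExp (Real.exp (-v) • ξ) u) N :=
  (hN.const_mul (t * (3 * (1 + ‖ξ‖ ^ 2)))).mono'
    (aestronglyMeasurable_intervalIntegral_compExp N ξ ht)
    (ae_of_all _ fun u => norm_intervalIntegral_compExp_le ξ u ht)

lemma integral_compExp_sub_integral_compExp {N : Measure E} [SigmaFinite N]
    (hN : Integrable (fun u : E => min 1 (‖u‖ ^ 2)) N)
    (hν : Integrable (fun u : E => min 1 (‖u‖ ^ 2)) (radialMeasure N)) (ξ : E) {t : ℝ}
    (ht : 0 ≤ t) :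
    (∫ u, compExp ξ u ∂(radialMeasure N)) - ∫ u, compExp (Real.exp (-t) • ξ) u ∂(radialMeasure N)
      = (∫ u, (∫ v in (0 : ℝ)..t, compExp (Real.exp (-v) • ξ) u) ∂N)
        - Complex.I * (((1 - Real.exp (-t)) * ∫ u, bigJump ξ u ∂N : ℝ) : ℂ) := by
  have hi : Integrable (fun u => compExp ξ u - compExp (Real.exp (-t) • ξ) u)
      (radialMeasure N) :=
    (integrable_compExp hν ξ).sub (integrable_compExp hν (Real.exp (-t) • ξ))
  rw [← integral_sub (integrable_compExp hν ξ) (integrable_compExp hν _)]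
  unfold radialMeasure at hi ⊢
  rw [integral_map measurable_exp_neg_smul.aemeasurable hi.aestronglyMeasurable]
  have hi2 := (integrable_map_measure hi.aestronglyMeasurable
    measurable_exp_neg_smul.aemeasurable).1 hi
  refine (integral_prod _ hi2).trans ?_
  simp only [Function.comp_apply, integral_compExp_radial_sub ξ _ ht]
  have hb : Integrable (fun u => Complex.I * (((1 - Real.exp (-t)) * bigJump ξ u : ℝ) : ℂ)) N :=
    ((integrable_bigJump hN ξ).const_mul _).ofReal.const_mul _
  rw [integral_sub (integrable_intervalIntegral_compExp hN ξ ht) hb, integral_const_mul,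
    integral_complex_ofReal, integral_const_mul]

/-- The Lévy exponent with drift `b` and Lévy measure `N`. -/
def levyExponent (b : E) (N : Measure E) (ξ : E) : ℂ :=
  Complex.I * ((⟪b, ξ⟫ : ℝ) : ℂ) + ∫ u, compExp ξ u ∂N

/-- The integral over `[0, t]` of the Lévy exponent along `v ↦ e^{-v} ξ`. -/
def flowExponent (b : E) (N : Measure E) (t : ℝ) (ξ : E) : ℂ :=
  Complex.I * (((1 - Real.exp (-t)) * ⟪b, ξ⟫ : ℝ) : ℂ)
    + ∫ u, (∫ v in (0 : ℝ)..t, compExp (Real.exp (-v) • ξ) u) ∂N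

lemma norm_flowExponent_le (b : E) {N : Measure E}
    (hN : Integrable (fun u : E => min 1 (‖u‖ ^ 2)) N) (ξ : E) {t : ℝ} (ht : 0 ≤ t) :
    ‖flowExponent b N t ξ‖
      ≤ t * ((‖b‖ + 3 * ∫ u, min 1 (‖u‖ ^ 2) ∂N) * (1 + ‖ξ‖ ^ 2)) := by
  have h1 : ‖Complex.I * (((1 - Real.exp (-t)) * ⟪b, ξ⟫ : ℝ) : ℂ)‖ ≤ t * (‖b‖ * (1 + ‖ξ‖ ^ 2)) := by
    rw [norm_mul, Complex.norm_I, one_mul, Complex.norm_real, norm_mul]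
    have h2 : Real.exp (-t) ≤ 1 := Real.exp_le_one_iff.2 (by linarith)
    rw [Real.norm_of_nonneg (by linarith)]
    have h3 : 1 - Real.exp (-t) ≤ t := by linarith [Real.add_one_le_exp (-t)]
    have h4 : ‖⟪b, ξ⟫‖ ≤ ‖b‖ * (1 + ‖ξ‖ ^ 2) := by
      refine (norm_inner_le_norm b ξ).trans ?_
      gcongr
      nlinarith [sq_nonneg (‖ξ‖ - 1), sq_nonneg ‖ξ‖]
    gcongr
  have h2 : ‖∫ u, (∫ v in (0 : ℝ)..t, compExp (Real.exp (-v) • ξ) u) ∂N‖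
      ≤ t * (3 * (1 + ‖ξ‖ ^ 2)) * ∫ u, min 1 (‖u‖ ^ 2) ∂N := by
    rw [← integral_const_mul]
    exact norm_integral_le_of_norm_le (hN.const_mul _)
      (ae_of_all _ fun u => norm_intervalIntegral_compExp_le ξ u ht)
  refine (norm_add_le _ _).trans ((add_le_add h1 h2).trans (le_of_eq ?_))
  ring

lemma tendsto_one_sub_exp_neg_div :
    Tendsto (fun t : ℝ => t⁻¹ * (1 - Real.exp (-t))) (𝓝[>] 0) (𝓝 1) := by
  have h : HasDerivAt (fun t : ℝ => 1 - Real.exp (-t)) 1 0 := by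
    have := ((Real.hasDerivAt_exp (-0)).comp (0 : ℝ) (hasDerivAt_neg (0 : ℝ))).const_sub 1
    simpa using this
  have h2 := h.tendsto_slope_zero_right
  simpa using h2

lemma tendsto_flowExponent_div (b : E) {N : Measure E}
    (hN : Integrable (fun u : E => min 1 (‖u‖ ^ 2)) N) (ξ : E) :
    Tendsto (fun t : ℝ => (t : ℂ)⁻¹ * flowExponent b N t ξ) (𝓝[>] 0)
      (𝓝 (levyExponent b N ξ)) := by
  have hpos : ∀ᶠ t : ℝ in 𝓝[>] 0, 0 < t := self_mem_nhdsWithin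
  have h1 : Tendsto (fun t : ℝ => Complex.I * ((t⁻¹ * (1 - Real.exp (-t)) * ⟪b, ξ⟫ : ℝ) : ℂ))
      (𝓝[>] 0) (𝓝 (Complex.I * ((⟪b, ξ⟫ : ℝ) : ℂ))) := by
    have := (tendsto_one_sub_exp_neg_div.mul_const ⟪b, ξ⟫)
    rw [one_mul] at this
    exact ((Complex.continuous_ofReal.tendsto _).comp this).const_mul _
  have h2 : Tendsto (fun t : ℝ => ∫ u, (t : ℂ)⁻¹ *
      (∫ v in (0 : ℝ)..t, compExp (Real.exp (-v) • ξ) u) ∂N) (𝓝[>] 0)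
      (𝓝 (∫ u, compExp ξ u ∂N)) := by
    refine tendsto_integral_filter_of_dominated_convergence
      (fun u => 3 * (1 + ‖ξ‖ ^ 2) * min 1 (‖u‖ ^ 2)) ?_ ?_ (hN.const_mul _) ?_
    · filter_upwards [hpos] with t ht
      exact (aestronglyMeasurable_intervalIntegral_compExp N ξ ht.le).const_mul _
    · filter_upwards [hpos] with t ht
      refine ae_of_all _ fun u => ?_
      rw [norm_mul, norm_inv, Complex.norm_real, Real.norm_of_nonneg ht.le,
        inv_mul_le_iff₀ ht, ← mul_assoc]
      exact norm_intervalIntegral_compExp_le ξ u ht.le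
    · refine ae_of_all _ fun u => ?_
      have hc : Continuous (fun v : ℝ => compExp (Real.exp (-v) • ξ) u) :=
        (continuous_compExp_left u).comp (by fun_prop)
      have hd := (hc.integral_hasStrictDerivAt 0 0).hasDerivAt.tendsto_slope_zero_right
      simpa [Complex.real_smul] using hd
  refine (h1.add h2).congr' ?_
  filter_upwards with t
  rw [flowExponent, mul_add, integral_const_mul]
  push_cast
  ring

lemma tendsto_exp_flowExponent_sub_one_div (b : E) {N : Measure E}
    (hN : Integrable (fun u : E => min 1 (‖u‖ ^ 2)) N) (ξ : E) :
    Tendsto (fun t : ℝ => (t : ℂ)⁻¹ * (Complex.exp (flowExponent b N t ξ) - 1)) (𝓝[>] 0)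
      (𝓝 (levyExponent b N ξ)) := by
  have h0 : flowExponent b N 0 ξ = 0 := by simp [flowExponent]
  have hd : HasDerivWithinAt (fun t : ℝ => flowExponent b N t ξ) (levyExponent b N ξ)
      (Ioi 0) 0 := by
    rw [hasDerivWithinAt_iff_tendsto_slope' self_notMem_Ioi]
    refine (tendsto_flowExponent_div b hN ξ).congr fun t => ?_
    simp [slope, h0, Complex.real_smul]
  have he := hd.cexp
  rw [hasDerivWithinAt_iff_tendsto_slope' self_notMem_Ioi, h0] at he
  simp only [Complex.exp_zero, one_mul] at he
  refine he.congr fun t => ?_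
  simp [slope, h0, Complex.real_smul]

lemma norm_exp_sub_one_le_two_mul {w : ℂ} (hw : ‖Complex.exp w‖ ≤ 1) :
    ‖Complex.exp w - 1‖ ≤ 2 * ‖w‖ := by
  rcases le_or_gt ‖w‖ 1 with h | h
  · exact Complex.norm_exp_sub_one_le h
  · have := norm_sub_le (Complex.exp w) 1
    rw [norm_one] at this
    linarith

end RadialCumulant

section FourierRepresentation

open scoped FourierTransform SchwartzMap

variable {E : Type*} [NormedAddCommGroup E] [InnerProductSpace ℝ E] [FiniteDimensional ℝ E]
  [MeasurableSpace E] [BorelSpace E]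

lemma SchwartzMap.exists_integral_exp_eq (f : 𝓢(E, ℝ)) :
    ∃ G : E → ℂ, Continuous G ∧ Integrable (fun η => (1 + ‖η‖ ^ 2) * ‖G η‖) ∧
      ∀ y, (f y : ℂ) = ∫ η, G η * Complex.exp (Complex.I * ((⟪η, y⟫ : ℝ) : ℂ)) := by
  set F : 𝓢(E, ℂ) := f.postcompCLM Complex.ofRealCLM with hF
  set H : 𝓢(E, ℂ) := 𝓕⁻ F with hH
  have hFH : 𝓕 H = F := FourierTransform.fourier_fourierInv_eq F
  set R : ℝ := -(2 * Real.pi) with hR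
  have hR0 : R ≠ 0 := by simp [hR, Real.pi_ne_zero]
  set c : ℝ := |(R ^ Module.finrank ℝ E)⁻¹| with hc
  have hc0 : 0 ≤ c := abs_nonneg _
  refine ⟨fun η => (c : ℂ) * H (R⁻¹ • η), by fun_prop, ?_, fun y => ?_⟩
  · have h1 : Integrable (fun ξ : E => (1 + R ^ 2 * ‖ξ‖ ^ 2) * ‖H ξ‖) := by
      refine ((H.integrable_pow_mul volume 0).add
        ((H.integrable_pow_mul volume 2).const_mul (R ^ 2))).congr (ae_of_all _ fun ξ => ?_)
      simp only [Pi.add_apply]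
      ring
    refine ((h1.comp_smul (inv_ne_zero hR0)).const_mul c).congr (ae_of_all _ fun η => ?_)
    simp only
    rw [norm_mul, Complex.norm_of_nonneg hc0, norm_smul, mul_pow, norm_inv, inv_pow,
      Real.norm_eq_abs, sq_abs]
    field_simp
  · have h1 : (f y : ℂ) = (𝓕 H) y := by
      rw [hFH, hF, SchwartzMap.postcompCLM_apply]
      rfl
    have h2 := Measure.integral_comp_smul (volume : Measure E)
      (fun η => H (R⁻¹ • η) * Complex.exp (Complex.I * ((⟪η, y⟫ : ℝ) : ℂ))) R
    rw [h1, SchwartzMap.fourier_coe, Real.fourier_eq']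
    simp only [mul_assoc, integral_const_mul]
    rw [← hc, Complex.real_smul] at h2
    rw [← h2]
    refine integral_congr_ae (ae_of_all _ fun ξ => ?_)
    simp only [smul_smul, inv_mul_cancel₀ hR0, one_smul, real_inner_smul_left, smul_eq_mul]
    rw [mul_comm, mul_comm Complex.I, hR]
    ring_nf

/-- If `f` is the Fourier integral of `G`, then its derivative is obtained by differentiating
under the integral sign. -/
lemma inner_gradient_eq_integral {f : E → ℝ} {x : E} (hd : DifferentiableAt ℝ f x) {G : E → ℂ}
    (hG : Continuous G) (hGi : Integrable (fun η => (1 + ‖η‖ ^ 2) * ‖G η‖))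
    (hf : ∀ y, (f y : ℂ) = ∫ η, G η * Complex.exp (Complex.I * ((⟪η, y⟫ : ℝ) : ℂ))) (a : E) :
    ((⟪gradient f x, a⟫ : ℝ) : ℂ) = ∫ η, G η * Complex.exp (Complex.I * ((⟪η, x⟫ : ℝ) : ℂ))
      * (Complex.I * ((⟪η, a⟫ : ℝ) : ℂ)) := by
  have hline : HasDerivAt (fun s : ℝ => x + s • a) a 0 := by
    simpa using ((hasDerivAt_id (0 : ℝ)).smul_const a).const_add x
  have h1 : HasDerivAt (fun s : ℝ => f (x + s • a)) ⟪gradient f x, a⟫ 0 := by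
    have hg : HasFDerivAt f (InnerProductSpace.toDual ℝ E (gradient f x)) (x + (0 : ℝ) • a) := by
      simpa using hd.hasGradientAt.hasFDerivAt
    exact hg.comp_hasDerivAt (0 : ℝ) hline
  have h2 := h1.ofReal_comp
  have hfun : (fun s : ℝ => ((f (x + s • a) : ℝ) : ℂ))
      = fun s : ℝ => ∫ η, G η * Complex.exp (Complex.I * ((⟪η, x + s • a⟫ : ℝ) : ℂ)) := by
    ext s; exact hf _
  have hGn : ∀ η : E, ‖G η‖ ≤ (1 + ‖η‖ ^ 2) * ‖G η‖ := fun η =>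
    le_mul_of_one_le_left (norm_nonneg _) (by nlinarith [sq_nonneg ‖η‖])
  have hexp : ∀ r : ℝ, ‖Complex.exp (Complex.I * (r : ℂ))‖ = 1 := Complex.norm_exp_I_mul_ofReal
  have h3 := (hasDerivAt_integral_of_dominated_loc_of_deriv_le (μ := (volume : Measure E))
    (F := fun (s : ℝ) η => G η * Complex.exp (Complex.I * ((⟪η, x + s • a⟫ : ℝ) : ℂ)))
    (F' := fun (s : ℝ) η => G η * (Complex.exp (Complex.I * ((⟪η, x + s • a⟫ : ℝ) : ℂ))
      * (Complex.I * ((⟪η, a⟫ : ℝ) : ℂ)))) (x₀ := (0 : ℝ))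
    (bound := fun η => ‖a‖ * ((1 + ‖η‖ ^ 2) * ‖G η‖))
    (s := univ) univ_mem
    (Eventually.of_forall fun s => Continuous.aestronglyMeasurable (by fun_prop))
    (hGi.mono' (Continuous.aestronglyMeasurable (by fun_prop)) (ae_of_all _ fun η => by
      rw [norm_mul, hexp, mul_one]; exact hGn η))
    (Continuous.aestronglyMeasurable (by fun_prop))
    (ae_of_all _ fun η s _ => by
      rw [norm_mul, norm_mul, norm_mul, hexp, Complex.norm_I, one_mul, one_mul, Complex.norm_real]
      have := norm_inner_le_norm (𝕜 := ℝ) η a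
      have h4 : ‖η‖ ≤ 1 + ‖η‖ ^ 2 := by nlinarith [sq_nonneg (‖η‖ - 1), sq_nonneg ‖η‖]
      calc ‖G η‖ * ‖⟪η, a⟫‖ ≤ ‖G η‖ * ((1 + ‖η‖ ^ 2) * ‖a‖) := by
            gcongr; exact this.trans (by gcongr)
        _ = ‖a‖ * ((1 + ‖η‖ ^ 2) * ‖G η‖) := by ring)
    (hGi.const_mul _)
    (ae_of_all _ fun η s _ => by
      have h5 : HasDerivAt (fun s : ℝ => ⟪η, x + s • a⟫) ⟪η, a⟫ s := by
        simp only [inner_add_right, real_inner_smul_right]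
        simpa using ((hasDerivAt_id s).mul_const ⟪η, a⟫).const_add ⟪η, x⟫
      exact ((h5.ofReal_comp.const_mul Complex.I).cexp).const_mul (G η))).2
  rw [hfun] at h2
  rw [h2.unique h3]
  simp only [zero_smul, add_zero, mul_assoc]

end FourierRepresentation

section Generator

variable {E : Type*} [NormedAddCommGroup E] [InnerProductSpace ℝ E] [FiniteDimensional ℝ E]
  [MeasurableSpace E] [BorelSpace E]

lemma integrable_mul_exp_inner {G : E → ℂ} (hG : Continuous G)
    (hGi : Integrable (fun η => (1 + ‖η‖ ^ 2) * ‖G η‖)) (y : E) :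
    Integrable (fun η => G η * Complex.exp (Complex.I * ((⟪η, y⟫ : ℝ) : ℂ))) :=
  hGi.mono' (Continuous.aestronglyMeasurable (by fun_prop)) (ae_of_all _ fun η => by
    rw [norm_mul, Complex.norm_exp_I_mul_ofReal, mul_one]
    exact le_mul_of_one_le_left (norm_nonneg _) (by nlinarith [sq_nonneg ‖η‖]))

lemma integrable_mul_exp_inner_mul_inner {G : E → ℂ} (hG : Continuous G)
    (hGi : Integrable (fun η => (1 + ‖η‖ ^ 2) * ‖G η‖)) (x a : E) :
    Integrable (fun η => G η * Complex.exp (Complex.I * ((⟪η, x⟫ : ℝ) : ℂ))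
      * (Complex.I * ((⟪η, a⟫ : ℝ) : ℂ))) :=
  (hGi.const_mul ‖a‖).mono' (Continuous.aestronglyMeasurable (by fun_prop))
    (ae_of_all _ fun η => by
      rw [norm_mul, norm_mul, norm_mul, Complex.norm_exp_I_mul_ofReal, Complex.norm_I, one_mul,
        mul_one, Complex.norm_real]
      have h1 := norm_inner_le_norm (𝕜 := ℝ) η a
      have h2 : ‖η‖ ≤ 1 + ‖η‖ ^ 2 := by nlinarith [sq_nonneg (‖η‖ - 1), sq_nonneg ‖η‖]
      calc ‖G η‖ * ‖⟪η, a⟫‖ ≤ ‖G η‖ * ((1 + ‖η‖ ^ 2) * ‖a‖) := by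
            gcongr; exact h1.trans (by gcongr)
        _ = ‖a‖ * ((1 + ‖η‖ ^ 2) * ‖G η‖) := by ring)

lemma integral_mul_compExp {f : E → ℝ} {x : E} (hd : DifferentiableAt ℝ f x) {G : E → ℂ}
    (hG : Continuous G) (hGi : Integrable (fun η => (1 + ‖η‖ ^ 2) * ‖G η‖))
    (hf : ∀ y, (f y : ℂ) = ∫ η, G η * Complex.exp (Complex.I * ((⟪η, y⟫ : ℝ) : ℂ))) (u : E) :
    ∫ η, G η * Complex.exp (Complex.I * ((⟪η, x⟫ : ℝ) : ℂ)) * compExp η u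
      = ((f (x + u) - f x - (if ‖u‖ ≤ 1 then ⟪gradient f x, u⟫ else 0) : ℝ) : ℂ) := by
  have hpt : ∀ η, G η * Complex.exp (Complex.I * ((⟪η, x⟫ : ℝ) : ℂ)) * compExp η u
      = G η * Complex.exp (Complex.I * ((⟪η, x + u⟫ : ℝ) : ℂ))
        - G η * Complex.exp (Complex.I * ((⟪η, x⟫ : ℝ) : ℂ))
        - (if ‖u‖ ≤ 1 then 1 else 0) * (G η * Complex.exp (Complex.I * ((⟪η, x⟫ : ℝ) : ℂ))
          * (Complex.I * ((⟪η, u⟫ : ℝ) : ℂ))) := fun η => by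
    rw [compExp, inner_add_right, Complex.ofReal_add, mul_add Complex.I, Complex.exp_add]
    split_ifs <;> ring
  have hxu := integrable_mul_exp_inner hG hGi (x + u)
  have hx := integrable_mul_exp_inner hG hGi x
  have hsub : Integrable (fun η => G η * Complex.exp (Complex.I * ((⟪η, x + u⟫ : ℝ) : ℂ))
      - G η * Complex.exp (Complex.I * ((⟪η, x⟫ : ℝ) : ℂ))) := hxu.sub hx
  simp only [hpt]
  rw [integral_sub hsub
    ((integrable_mul_exp_inner_mul_inner hG hGi x u).const_mul _), integral_sub hxu hx,
    integral_const_mul, ← hf, ← hf, ← inner_gradient_eq_integral hd hG hGi hf]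
  split_ifs <;> simp

lemma integral_mul_levyExponent {f : E → ℝ} {x : E} (hd : DifferentiableAt ℝ f x) {G : E → ℂ}
    (hG : Continuous G) (hGi : Integrable (fun η => (1 + ‖η‖ ^ 2) * ‖G η‖))
    (hf : ∀ y, (f y : ℂ) = ∫ η, G η * Complex.exp (Complex.I * ((⟪η, y⟫ : ℝ) : ℂ)))
    {N : Measure E} [SigmaFinite N] (hN : Integrable (fun u : E => min 1 (‖u‖ ^ 2)) N) (a : E) :
    ∫ η, G η * Complex.exp (Complex.I * ((⟪η, x⟫ : ℝ) : ℂ)) * levyExponent a N η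
      = ((⟪a, gradient f x⟫ + ∫ u, (f (x + u) - f x
          - (if ‖u‖ ≤ 1 then ⟪gradient f x, u⟫ else 0)) ∂N : ℝ) : ℂ) := by
  have hint : Integrable (Function.uncurry fun (η u : E) =>
      G η * Complex.exp (Complex.I * ((⟪η, x⟫ : ℝ) : ℂ)) * compExp η u)
      ((volume : Measure E).prod N) := by
    refine ((hGi.mul_prod hN).const_mul 3).mono' ?_ (ae_of_all _ fun p => ?_)
    · have h1 : Measurable (fun p : E × E => G p.1
          * Complex.exp (Complex.I * ((⟪p.1, x⟫ : ℝ) : ℂ))) :=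
        Continuous.measurable (by fun_prop)
      exact (h1.mul measurable_compExp).aestronglyMeasurable
    · simp only [Function.uncurry]
      rw [norm_mul, norm_mul, Complex.norm_exp_I_mul_ofReal, mul_one]
      calc ‖G p.1‖ * ‖compExp p.1 p.2‖
          ≤ ‖G p.1‖ * (3 * (1 + ‖p.1‖ ^ 2) * min 1 (‖p.2‖ ^ 2)) := by
            gcongr; exact norm_compExp_le _ _
        _ = 3 * ((1 + ‖p.1‖ ^ 2) * ‖G p.1‖ * min 1 (‖p.2‖ ^ 2)) := by ring
  have hpt : ∀ η, G η * Complex.exp (Complex.I * ((⟪η, x⟫ : ℝ) : ℂ)) * levyExponent a N η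
      = G η * Complex.exp (Complex.I * ((⟪η, x⟫ : ℝ) : ℂ)) * (Complex.I * ((⟪η, a⟫ : ℝ) : ℂ))
        + ∫ u, G η * Complex.exp (Complex.I * ((⟪η, x⟫ : ℝ) : ℂ)) * compExp η u ∂N := fun η => by
    rw [levyExponent, mul_add, integral_const_mul, real_inner_comm η a]
  have hinner : Integrable (fun η => ∫ u, G η * Complex.exp (Complex.I * ((⟪η, x⟫ : ℝ) : ℂ))
      * compExp η u ∂N) := hint.integral_prod_left
  simp only [hpt]
  rw [integral_add (integrable_mul_exp_inner_mul_inner hG hGi x a) hinner,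
    ← inner_gradient_eq_integral hd hG hGi hf, integral_integral_swap hint]
  simp only [integral_mul_compExp hd hG hGi hf]
  rw [integral_complex_ofReal, real_inner_comm, Complex.ofReal_add]

lemma integral_comp_smul_add_eq {f : E → ℝ} {G : E → ℂ}
    (hG : Continuous G) (hGi : Integrable (fun η => (1 + ‖η‖ ^ 2) * ‖G η‖))
    (hf : ∀ y, (f y : ℂ) = ∫ η, G η * Complex.exp (Complex.I * ((⟪η, y⟫ : ℝ) : ℂ)))
    {m : Measure E} [IsFiniteMeasure m] (z : E) :
    ((∫ y, f (z + y) ∂m : ℝ) : ℂ)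
      = ∫ η, G η * Complex.exp (Complex.I * ((⟪η, z⟫ : ℝ) : ℂ))
        * ∫ y, Complex.exp (Complex.I * ((⟪η, y⟫ : ℝ) : ℂ)) ∂m := by
  have hint : Integrable (Function.uncurry fun (y η : E) =>
      G η * Complex.exp (Complex.I * ((⟪η, z⟫ : ℝ) : ℂ))
        * Complex.exp (Complex.I * ((⟪η, y⟫ : ℝ) : ℂ)))
      (m.prod (volume : Measure E)) := by
    refine (((integrable_const (1 : ℝ)).mul_prod hGi)).mono' ?_ (ae_of_all _ fun p => ?_)
    · exact Continuous.aestronglyMeasurable (by fun_prop)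
    · simp only [Function.uncurry]
      rw [norm_mul, norm_mul, Complex.norm_exp_I_mul_ofReal, Complex.norm_exp_I_mul_ofReal,
        mul_one, mul_one, one_mul]
      exact le_mul_of_one_le_left (norm_nonneg _) (by nlinarith [sq_nonneg ‖p.2‖])
  rw [← integral_complex_ofReal]
  simp only [hf, ← integral_const_mul]
  rw [← integral_integral_swap hint]
  refine integral_congr_ae (ae_of_all _ fun y => integral_congr_ae (ae_of_all _ fun η => ?_))
  simp only
  rw [inner_add_right, Complex.ofReal_add, mul_add, Complex.exp_add, mul_assoc]

lemma tendsto_integral_comp_sub_div {f : E → ℝ} {x : E} (hd : DifferentiableAt ℝ f x)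
    {G : E → ℂ} (hG : Continuous G) (hGi : Integrable (fun η => (1 + ‖η‖ ^ 2) * ‖G η‖))
    (hf : ∀ y, (f y : ℂ) = ∫ η, G η * Complex.exp (Complex.I * ((⟪η, y⟫ : ℝ) : ℂ)))
    {N : Measure E} [SigmaFinite N] (hN : Integrable (fun u : E => min 1 (‖u‖ ^ 2)) N)
    {m : ℝ → Measure E} (hm : ∀ t, 0 ≤ t → IsProbabilityMeasure (m t)) {a : E}
    (hchar : ∀ t, 0 ≤ t → ∀ η, ∫ y, Complex.exp (Complex.I * ((⟪η, y⟫ : ℝ) : ℂ)) ∂(m t)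
      = Complex.exp (flowExponent a N t η)) :
    Tendsto (fun t : ℝ => ((∫ y, f (Real.exp (-t) • x + y) ∂(m t)) - f x) / t) (𝓝[>] 0)
      (𝓝 (⟪a - x, gradient f x⟫ + ∫ u, (f (x + u) - f x
          - (if ‖u‖ ≤ 1 then ⟪gradient f x, u⟫ else 0)) ∂N)) := by
  have hpos : ∀ᶠ t : ℝ in 𝓝[>] 0, 0 < t := self_mem_nhdsWithin
  have hflow : ∀ t η, Complex.exp (Complex.I * ((⟪η, Real.exp (-t) • x⟫ : ℝ) : ℂ))
      * Complex.exp (flowExponent a N t η)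
      = Complex.exp (Complex.I * ((⟪η, x⟫ : ℝ) : ℂ))
        * Complex.exp (flowExponent (a - x) N t η) := fun t η => by
    rw [← Complex.exp_add, ← Complex.exp_add, flowExponent, flowExponent, inner_sub_left,
      real_inner_smul_right, real_inner_comm η x]
    congr 1
    push_cast
    ring
  have hle : ∀ t, 0 ≤ t → ∀ η, ‖Complex.exp (flowExponent (a - x) N t η)‖ ≤ 1 := fun t ht η => by
    have := hm t ht
    have h1 := congrArg norm (hflow t η)
    rw [norm_mul, norm_mul, Complex.norm_exp_I_mul_ofReal, Complex.norm_exp_I_mul_ofReal, one_mul,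
      one_mul] at h1
    rw [← h1, ← hchar t ht]
    refine (norm_integral_le_of_norm_le_const (C := 1) (ae_of_all _ fun y =>
      (Complex.norm_exp_I_mul_ofReal _).le)).trans ?_
    simp
  have hmeas : ∀ t, 0 ≤ t → Continuous (fun η : E => Complex.exp (flowExponent a N t η)) :=
    fun t ht => by
    have := hm t ht
    simp only [← hchar t ht]
    exact continuous_of_dominated (bound := fun _ => 1)
      (fun η => Continuous.aestronglyMeasurable (by fun_prop))
      (fun η => ae_of_all _ fun y => (Complex.norm_exp_I_mul_ofReal _).le)
      (integrable_const _) (ae_of_all _ fun y => by fun_prop)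
  have hmeas' : ∀ t, 0 ≤ t →
      Continuous (fun η : E => Complex.exp (flowExponent (a - x) N t η)) := fun t ht => by
    have h1 : (fun η : E => Complex.exp (flowExponent (a - x) N t η))
        = fun η => (Complex.exp (Complex.I * ((⟪η, x⟫ : ℝ) : ℂ)))⁻¹
          * (Complex.exp (Complex.I * ((⟪η, Real.exp (-t) • x⟫ : ℝ) : ℂ))
          * Complex.exp (flowExponent a N t η)) := by
      ext η
      rw [hflow, inv_mul_cancel_left₀ (Complex.exp_ne_zero _)]
    have h2 := hmeas t ht
    simp only [h1, ← Complex.exp_neg]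
    fun_prop
  have key : Tendsto (fun t : ℝ => ∫ η, G η * Complex.exp (Complex.I * ((⟪η, x⟫ : ℝ) : ℂ))
      * ((t : ℂ)⁻¹ * (Complex.exp (flowExponent (a - x) N t η) - 1))) (𝓝[>] 0)
      (𝓝 (∫ η, G η * Complex.exp (Complex.I * ((⟪η, x⟫ : ℝ) : ℂ))
        * levyExponent (a - x) N η)) := by
    set K : ℝ := ‖a - x‖ + 3 * ∫ u, min 1 (‖u‖ ^ 2) ∂N
    refine tendsto_integral_filter_of_dominated_convergence
      (fun η => 2 * K * ((1 + ‖η‖ ^ 2) * ‖G η‖)) ?_ ?_ (hGi.const_mul _) ?_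
    · filter_upwards [hpos] with t ht
      have h2 := hmeas' t ht.le
      exact Continuous.aestronglyMeasurable (by fun_prop)
    · filter_upwards [hpos] with t ht
      refine ae_of_all _ fun η => ?_
      have h3 := (norm_exp_sub_one_le_two_mul (hle t ht.le η)).trans
        (mul_le_mul_of_nonneg_left (norm_flowExponent_le (a - x) hN η ht.le) zero_le_two)
      rw [norm_mul, norm_mul, Complex.norm_exp_I_mul_ofReal, mul_one, norm_mul, norm_inv,
        Complex.norm_of_nonneg ht.le]
      calc _ ≤ ‖G η‖ * (t⁻¹ * (2 * (t * (K * (1 + ‖η‖ ^ 2))))) := by gcongr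
        _ = 2 * K * ((1 + ‖η‖ ^ 2) * ‖G η‖) := by field_simp
    · exact ae_of_all _ fun η => (tendsto_exp_flowExponent_sub_one_div (a - x) hN η).const_mul _
  rw [integral_mul_levyExponent hd hG hGi hf hN] at key
  have key2 := (Complex.continuous_re.tendsto _).comp key
  rw [Complex.ofReal_re] at key2
  refine key2.congr' ?_
  filter_upwards [hpos] with t ht
  have := hm t ht.le
  rw [Function.comp_apply, ← Complex.ofReal_re (_ / t)]
  congr 1
  have hi : Integrable (fun η => G η * Complex.exp (Complex.I * ((⟪η, x⟫ : ℝ) : ℂ))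
      * Complex.exp (flowExponent (a - x) N t η)) := by
    have h2 := hmeas' t ht.le
    refine hGi.mono' (Continuous.aestronglyMeasurable (by fun_prop)) (ae_of_all _ fun η => ?_)
    rw [norm_mul, norm_mul, Complex.norm_exp_I_mul_ofReal, mul_one, mul_comm]
    gcongr
    exact (hle t ht.le η).trans (by nlinarith [sq_nonneg ‖η‖])
  rw [Complex.ofReal_div, Complex.ofReal_sub, integral_comp_smul_add_eq hG hGi hf, hf x]
  simp only [hchar t ht.le, mul_assoc, hflow]
  simp only [← mul_assoc]
  rw [← integral_sub hi (integrable_mul_exp_inner hG hGi x), div_eq_inv_mul, ← integral_const_mul]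
  refine integral_congr_ae (ae_of_all _ fun η => ?_)
  simp only
  ring

end Generator

/-- The generator of the semigroup `(P_t^ν)` on Schwartz functions
(`lem:genSDLaws`). -/
theorem stmt5 {d : ℕ}
    (μX : Measure (EuclideanSpace ℝ (Fin d))) [IsProbabilityMeasure μX]
    (μt : ℝ → Measure (EuclideanSpace ℝ (Fin d)))
    (ν νt : Measure (EuclideanSpace ℝ (Fin d)))
    (σ : Measure (EuclideanSpace ℝ (Fin d))) [IsFiniteMeasure σ]
    (τ : EuclideanSpace ℝ (Fin d) → Measure ℝ)
    (b : EuclideanSpace ℝ (Fin d))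
    (k : EuclideanSpace ℝ (Fin d) → ℝ → ℝ)
    (hnondeg : ∀ (v : EuclideanSpace ℝ (Fin d)) (c : ℝ), v ≠ 0 →
      μX {x : EuclideanSpace ℝ (Fin d) | ⟪v, x⟫ = c} ≠ 1)
    (hσ : σ {x : EuclideanSpace ℝ (Fin d) | ¬ ‖x‖ = 1} = 0)
    (hk0 : ∀ x, ∀ r : ℝ, 0 < r → 0 ≤ k x r)
    (hkcr : ∀ x, ContinuousOn (k x) (Ioi 0))
    (hkmono : ∀ x, AntitoneOn (k x) (Ioi 0))
    (hkcx : ∀ r : ℝ, 0 < r →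
      ContinuousOn (fun x => k x r) {x : EuclideanSpace ℝ (Fin d) | ‖x‖ = 1})
    (hklim0 : ∀ x, ‖x‖ = 1 → Tendsto (fun r => r ^ 2 * k x r) (𝓝[>] 0) (𝓝 0))
    (hkliminfty : ∀ x, ‖x‖ = 1 → Tendsto (k x) atTop (𝓝 0))
    (hpolar : ∀ g : EuclideanSpace ℝ (Fin d) → ℝ≥0∞, Measurable g →
      ∫⁻ u, g u ∂ν
        = ∫⁻ x, (∫⁻ r in Ioi (0 : ℝ), g (r • x) * ENNReal.ofReal (k x r / r)) ∂σ)
    (hτ : ∀ x : EuclideanSpace ℝ (Fin d),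
      (∀ a c : ℝ, 0 < a → a ≤ c → τ x (Ioc a c) = ENNReal.ofReal (k x a - k x c))
        ∧ τ x (Iic 0) = 0)
    (hνt : ∀ g : EuclideanSpace ℝ (Fin d) → ℝ≥0∞, Measurable g →
      ∫⁻ u, g u ∂νt = ∫⁻ x, (∫⁻ r, g (r • x) ∂(τ x)) ∂σ)
    (hchar : ∀ ξ, charFn μX ξ
      = Complex.exp (Complex.I * ((⟪b, ξ⟫ : ℝ) : ℂ)
          + ∫ u, (Complex.exp (Complex.I * ((⟪ξ, u⟫ : ℝ) : ℂ)) - 1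
              - (if ‖u‖ ≤ 1 then Complex.I * ((⟪ξ, u⟫ : ℝ) : ℂ) else 0)) ∂ν))
    (hμt0 : μt 0 = Measure.dirac 0)
    (hμtprob : ∀ t : ℝ, 0 ≤ t → IsProbabilityMeasure (μt t))
    (hμtchar : ∀ t : ℝ, 0 ≤ t → ∀ ξ,
      charFn (μt t) ξ = charFn μX ξ / charFn μX (Real.exp (-t) • ξ)) :
    ∀ (f : SchwartzMap (EuclideanSpace ℝ (Fin d)) ℝ) (x : EuclideanSpace ℝ (Fin d)),
      Tendsto (fun t : ℝ => (Pop μt (⇑f) t x - f x) / t) (𝓝[>] 0)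
        (𝓝 (⟪b - (∫ y, k y 1 • y ∂σ) - x, gradient (⇑f) x⟫
          + ∫ u, (f (x + u) - f x
              - (if ‖u‖ ≤ 1 then ⟪gradient (⇑f) x, u⟫ else 0)) ∂νt)) := by
  intro f x
  have hσ' : ∀ᵐ x ∂σ, ‖x‖ = 1 := hσ
  have h0 : ∀ x, τ x (Iic 0) = 0 := fun x => (hτ x).2
  have hIoi : ∀ x, ‖x‖ = 1 → ∀ r : ℝ, 0 < r → τ x (Ioi r) = ENNReal.ofReal (k x r) :=
    fun x hx r hr => measure_Ioi_of_measure_Ioc (hτ x).1 (hkliminfty x hx) hr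
  have hN0 : νt {0} = 0 := by
    rw [← lintegral_indicator_one (measurableSet_singleton _),
      hνt _ (measurable_one.indicator (measurableSet_singleton _)), ← lintegral_zero (μ := σ)]
    refine lintegral_congr_ae ?_
    filter_upwards [hσ'] with x hx
    rw [← lintegral_zero (μ := τ x)]
    refine lintegral_congr_ae ?_
    have hpos : ∀ᵐ r ∂(τ x), r ∉ Iic 0 := measure_eq_zero_iff_ae_notMem.1 (h0 x)
    filter_upwards [hpos] with r hr
    refine indicator_of_notMem (fun hmem => ?_) _
    rcases smul_eq_zero.1 (mem_singleton_iff.1 hmem) with h | h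
    · exact hr h.le
    · simp [h] at hx
  have hradial := fun g (hg : Measurable g) => lintegral_eq_of_polar hσ' h0 hIoi hpolar hνt hg
  have hνfin : ∫⁻ u, ENNReal.ofReal (min 1 (‖u‖ ^ 2)) ∂ν < ∞ :=
    lintegral_min_lt_top_of_nondegenerate hnondeg hk0 hkmono hpolar hchar
  have hν : Integrable (fun u => min 1 (‖u‖ ^ 2)) ν := integrable_min_of_lintegral hνfin
  have hN : Integrable (fun u => min 1 (‖u‖ ^ 2)) νt :=
    integrable_min_of_lintegral (lintegral_min_lt_top_of_radial hradial hνfin)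
  have : SigmaFinite νt := sigmaFinite_of_integrable_min hN0 hN
  have hνeq : ν = radialMeasure νt := eq_radialMeasure hradial
  obtain ⟨G, hG, hGi, hf⟩ := SchwartzMap.exists_integral_exp_eq f
  refine tendsto_integral_comp_sub_div f.differentiableAt hG hGi hf hN hμtprob fun t ht η => ?_
  have hX : ∀ ξ, charFn μX ξ
      = Complex.exp (Complex.I * ((⟪b, ξ⟫ : ℝ) : ℂ) + ∫ u, compExp ξ u ∂ν) := hchar
  have hflow := integral_compExp_sub_integral_compExp hN (hνeq ▸ hν) η ht
  rw [← hνeq, integral_bigJump hσ' hk0 (hkcx 1 one_pos) h0 hIoi hνt hN, sub_eq_iff_eq_add]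
    at hflow
  refine (hμtchar t ht η).trans ?_
  rw [hX, hX, ← Complex.exp_sub, hflow, flowExponent, inner_sub_left, real_inner_smul_right,
    real_inner_comm (∫ y, k y 1 • y ∂σ) η]
  congr 1
  push_cast
  ring
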